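/- For every integer k ≥ 2 and every positive integer n, the number of anti-lecture hall compositions of weight n with first entry at most 2k−3 equals the number of overpartitions of n whose non-overlined parts are not congruent to 0, 1, or −1 modulo 2k−1; that is, |F_{2k−3}(n)| = |H_{2k−1}(n)|. -/

import Mathlib

/-- `f : ℕ → ℕ` (with `f i` standing for `λ_{i+1}`) is an anti-lecture hall composition:
finitely many nonzero entries and `λ₁/1 ≥ λ₂/2 ≥ λ₃/3 ≥ ⋯ ≥ 0`, i.e.
`(i+1)·λ_i ≥ i·λ_{i+1}` for all `i ≥ 1`. -/
def IsALH (f : ℕ → ℕ) : Prop :=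
  (Function.support f).Finite ∧ ∀ i : ℕ, (i + 1) * f (i + 1) ≤ (i + 2) * f i

/-- The weight `|λ| = λ₁ + λ₂ + ⋯` of a composition. -/
noncomputable def wt (f : ℕ → ℕ) : ℕ := ∑ᶠ i, f i

/-- `F k n`: anti-lecture hall compositions of weight `n` whose first entry is at most `k`. -/
def Fset (k n : ℕ) : Set (ℕ → ℕ) := {f | IsALH f ∧ f 0 ≤ k ∧ wt f = n}

/-- `H k n`: overpartitions of `n` (pairs `(μ, ν)` of multisets of positive integers with `μ`,
the overlined parts, having distinct parts) such that no non-overlined part (part of `ν`) is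
congruent to `0`, `1`, or `-1` modulo `k`. -/
def Hset (k n : ℕ) : Set (Multiset ℕ × Multiset ℕ) :=
  {p | p.1.Nodup ∧ (∀ x ∈ p.1, 0 < x) ∧
    (∀ x ∈ p.2, 0 < x ∧ x % k ≠ 0 ∧ x % k ≠ 1 ∧ x % k ≠ k - 1) ∧
    p.1.sum + p.2.sum = n}

section qSeries

open Finset

/-- The finite product `(1 - q)(1 - q²)⋯(1 - qᵃ)`. -/
def qFact {R : Type*} [CommRing R] (q : R) (a : ℕ) : R := ∏ i ∈ range a, (1 - q ^ (i + 1))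

/-- The Gaussian binomial coefficient `[a + b; a]` in base `q`. -/
def gaussBinom {R : Type*} [CommRing R] (q : R) : ℕ → ℕ → R
  | 0, _ => 1
  | _ + 1, 0 => 1
  | a + 1, b + 1 => gaussBinom q a (b + 1) + q ^ (a + 1) * gaussBinom q (a + 1) b

variable {R : Type*} [CommRing R]

@[simp] lemma qFact_zero (q : R) : qFact q 0 = 1 := by simp [qFact]

lemma qFact_succ (q : R) (a : ℕ) : qFact q (a + 1) = qFact q a * (1 - q ^ (a + 1)) :=
  prod_range_succ _ _

@[simp] lemma gaussBinom_zero_left (q : R) (b : ℕ) : gaussBinom q 0 b = 1 := by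
  rw [gaussBinom]

@[simp] lemma gaussBinom_zero_right (q : R) (a : ℕ) : gaussBinom q a 0 = 1 := by
  cases a <;> rw [gaussBinom]

lemma gaussBinom_succ_succ (q : R) (a b : ℕ) : gaussBinom q (a + 1) (b + 1) =
    gaussBinom q a (b + 1) + q ^ (a + 1) * gaussBinom q (a + 1) b := by
  rw [gaussBinom]

lemma map_gaussBinom {S : Type*} [CommRing S] (φ : R →+* S) (q : R) (a b : ℕ) :
    φ (gaussBinom q a b) = gaussBinom (φ q) a b := by
  induction a generalizing b with
  | zero => simp
  | succ a iha =>
    induction b with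
    | zero => simp
    | succ b ihb => simp [gaussBinom_succ_succ, iha, ihb]

lemma map_qFact {S : Type*} [CommRing S] (φ : R →+* S) (q : R) (a : ℕ) :
    φ (qFact q a) = qFact (φ q) a := by
  simp [qFact, map_prod]

lemma gaussBinom_mul_qFact (q : R) (a b : ℕ) :
    gaussBinom q a b * (qFact q a * qFact q b) = qFact q (a + b) := by
  induction a generalizing b with
  | zero => simp
  | succ a iha =>
    induction b with
    | zero => simp
    | succ b ihb =>
      have h1 := iha (b + 1)
      rw [gaussBinom_succ_succ, show a + 1 + (b + 1) = (a + b + 1) + 1 by ring]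
      rw [show a + (b + 1) = a + b + 1 by ring] at h1
      rw [show a + 1 + b = a + b + 1 by ring] at ihb
      simp only [qFact_succ] at *
      linear_combination (1 - q ^ (a + 1)) * h1 + q ^ (a + 1) * (1 - q ^ (b + 1)) * ihb

lemma sum_antidiagonal_succ_mul_gaussBinom (q : R) (F : ℕ → ℕ → R) (n : ℕ) :
    ∑ p ∈ antidiagonal (n + 1), F p.1 p.2 * gaussBinom q p.1 p.2 =
      ∑ p ∈ antidiagonal n,
        (F (p.1 + 1) p.2 + q ^ p.1 * F p.1 (p.2 + 1)) * gaussBinom q p.1 p.2 := by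
  simp only [add_mul, sum_add_distrib]
  cases n with
  | zero => simp [Nat.sum_antidiagonal_succ, add_comm]
  | succ n =>
    rw [Nat.sum_antidiagonal_succ, Nat.sum_antidiagonal_succ',
      Nat.sum_antidiagonal_succ' (f := fun p => F (p.1 + 1) p.2 * gaussBinom q p.1 p.2),
      Nat.sum_antidiagonal_succ (f := fun p => q ^ p.1 * F p.1 (p.2 + 1) * gaussBinom q p.1 p.2)]
    simp only [gaussBinom_succ_succ, gaussBinom_zero_left, gaussBinom_zero_right, mul_add,
      sum_add_distrib, pow_zero, one_mul, mul_one]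
    have h : ∀ p : ℕ × ℕ, F (p.1 + 1) (p.2 + 1) * (q ^ (p.1 + 1) * gaussBinom q (p.1 + 1) p.2) =
        q ^ (p.1 + 1) * F (p.1 + 1) (p.2 + 1) * gaussBinom q (p.1 + 1) p.2 := fun p => by ring
    simp only [h]
    ring

/-- The `q`-binomial theorem. -/
lemma prod_one_add_mul_pow (q y : R) (n : ℕ) :
    ∏ i ∈ range n, (1 + y * q ^ i) =
      ∑ p ∈ antidiagonal n, q ^ (p.1.choose 2) * y ^ p.1 * gaussBinom q p.1 p.2 := by
  induction n generalizing y with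
  | zero => simp
  | succ n ih =>
    rw [sum_antidiagonal_succ_mul_gaussBinom q (fun a _ => q ^ (a.choose 2) * y ^ a),
      prod_range_succ']
    have h : ∀ i, 1 + y * q ^ (i + 1) = 1 + (y * q) * q ^ i := fun i => by ring
    simp only [h, ih, pow_zero, mul_one]
    rw [sum_mul]
    refine sum_congr rfl fun p _ => ?_
    rw [Nat.choose_succ_succ' p.1 1, Nat.choose_one_right]
    ring

/-- The coefficients `(-1)ʳ Q^(r(r-1)/2) wʳ`, where `Q = z * w` and `r = j - b` may be negative. -/
def thetaCoeff (z w : R) (j b : ℕ) : R :=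
  if b ≤ j then (-1) ^ (j - b) * (z * w) ^ ((j - b).choose 2) * w ^ (j - b)
  else (-1) ^ (b - j) * (z * w) ^ ((b - j).choose 2) * z ^ (b - j)

lemma pow_mul_thetaCoeff_succ (z w : R) (j b : ℕ) :
    (z * w) ^ j * thetaCoeff z w j (b + 1) = -z * (z * w) ^ b * thetaCoeff z w j b := by
  unfold thetaCoeff
  rcases lt_trichotomy j b with h | rfl | h
  · obtain ⟨s, rfl⟩ := Nat.exists_eq_add_of_le h.le
    rw [if_neg (by omega), if_neg (by omega), show j + s + 1 - j = s + 1 by omega,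
      show j + s - j = s by omega, Nat.choose_succ_succ' s 1, Nat.choose_one_right]
    ring
  · simp
    ring
  · obtain ⟨s, rfl⟩ := Nat.exists_eq_add_of_le (Nat.succ_le_of_lt h)
    rw [if_pos (by omega), if_pos (by omega), show b.succ + s - (b + 1) = s by omega,
      show b.succ + s - b = s + 1 by omega, Nat.choose_succ_succ' s 1, Nat.choose_one_right]
    simp only [Nat.succ_eq_add_one]
    ring

/-- The finite form of the Jacobi triple product identity. -/
lemma prod_mul_prod_eq_sum_thetaCoeff (z w : R) (a b : ℕ) :
    (∏ i ∈ range a, (1 - w * (z * w) ^ i)) * ∏ i ∈ range b, (1 - z * (z * w) ^ i) =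
      ∑ p ∈ antidiagonal (a + b), thetaCoeff z w p.1 b * gaussBinom (z * w) p.1 p.2 := by
  induction b with
  | zero =>
    have h := prod_one_add_mul_pow (z * w) (-w) a
    simp only [neg_mul, ← sub_eq_add_neg] at h
    simp only [range_zero, prod_empty, mul_one, h, add_zero]
    refine sum_congr rfl fun p _ => ?_
    simp only [thetaCoeff, Nat.zero_le, if_true, Nat.sub_zero, neg_pow w]
    ring
  | succ b ih =>
    rw [prod_range_succ, ← mul_assoc, ih, sum_mul, ← add_assoc,
      sum_antidiagonal_succ_mul_gaussBinom _ (fun j _ => thetaCoeff z w j (b + 1))]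
    refine sum_congr rfl fun p _ => ?_
    rw [pow_mul_thetaCoeff_succ,
      show thetaCoeff z w (p.1 + 1) (b + 1) = thetaCoeff z w p.1 b by simp [thetaCoeff]]
    ring

lemma qFact_ne_zero [IsDomain R] {q : R} (hq : ∀ n, q ^ (n + 1) ≠ 1) (a : ℕ) :
    qFact q a ≠ 0 :=
  prod_ne_zero_iff.2 fun i _ => sub_ne_zero.2 (hq i).symm

lemma gaussBinom_comm [IsDomain R] {q : R} (hq : ∀ n, q ^ (n + 1) ≠ 1) (a b : ℕ) :
    gaussBinom q a b = gaussBinom q b a := by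
  refine mul_right_cancel₀ (mul_ne_zero (qFact_ne_zero hq a) (qFact_ne_zero hq b)) ?_
  rw [gaussBinom_mul_qFact, mul_comm (qFact q a), gaussBinom_mul_qFact, add_comm]

/-- The finite Jacobi triple product with the terms of index `r` and `-r - 1` collected. -/
lemma prod_mul_prod_succ_eq_sum [IsDomain R] {z w : R} (hq : ∀ n, (z * w) ^ (n + 1) ≠ 1) (a : ℕ) :
    (∏ i ∈ range a, (1 - w * (z * w) ^ i)) * ∏ i ∈ range (a + 1), (1 - z * (z * w) ^ i) =
      ∑ p ∈ antidiagonal a, (-1) ^ p.1 * (z * w) ^ (p.1.choose 2) * w ^ p.1 *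
        (1 - z ^ (2 * p.1 + 1)) * gaussBinom (z * w) p.2 (2 * p.1 + p.2 + 1) := by
  rw [prod_mul_prod_eq_sum_thetaCoeff,
    Nat.sum_antidiagonal_eq_sum_range_succ
      (fun i j => thetaCoeff z w i (a + 1) * gaussBinom (z * w) i j),
    Nat.sum_antidiagonal_eq_sum_range_succ
      (fun i j => (-1) ^ i * (z * w) ^ (i.choose 2) * w ^ i *
        (1 - z ^ (2 * i + 1)) * gaussBinom (z * w) j (2 * i + j + 1)),
    show (a + (a + 1)).succ = (a + 1) + (a + 1) by simp; ring, sum_range_add,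
    ← sum_range_reflect, ← sum_add_distrib]
  refine sum_congr rfl fun r hr => ?_
  obtain ⟨l, rfl⟩ := Nat.exists_eq_add_of_le (Nat.lt_succ_iff.1 (mem_range.1 hr))
  rw [show r + l + 1 - 1 - r = l by omega, show r + l + (r + l + 1) - l = 2 * r + l + 1 by omega,
    show r + l + (r + l + 1) - (r + l + 1 + r) = l by omega, show r + l - r = l by omega,
    show r + l + 1 + r = 2 * r + l + 1 by ring, gaussBinom_comm hq (2 * r + l + 1)]
  unfold thetaCoeff
  rw [if_neg (by omega), if_pos (by omega), show r + l + 1 - l = r + 1 by omega,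
    show 2 * r + l + 1 - (r + l + 1) = r by omega, Nat.choose_succ_succ' r 1, Nat.choose_one_right]
  ring

lemma sum_antidiagonal_antidiagonal_assoc (f : ℕ → ℕ → ℕ → R) (n : ℕ) :
    ∑ p ∈ antidiagonal n, ∑ s ∈ antidiagonal p.1, f s.1 s.2 p.2 =
      ∑ p ∈ antidiagonal n, ∑ s ∈ antidiagonal p.2, f p.1 s.1 s.2 := by
  rw [sum_sigma', sum_sigma']
  refine sum_nbij' (fun x => ⟨(x.2.1, x.2.2 + x.1.2), (x.2.2, x.1.2)⟩)
    (fun x => ⟨(x.1.1 + x.2.1, x.2.2), (x.1.1, x.2.1)⟩) ?_ ?_ ?_ ?_ ?_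
  all_goals
    rintro ⟨⟨a, b⟩, ⟨c, d⟩⟩ h
    simp only [mem_sigma, HasAntidiagonal.mem_antidiagonal] at h
    obtain ⟨h, rfl⟩ := h
  all_goals simp
  all_goals omega

/-- The product `(1 + q)(1 + q²)⋯(1 + qᵃ)`. -/
def qFactPlus (q : R) (a : ℕ) : R := ∏ i ∈ range a, (1 + q ^ (i + 1))

lemma map_qFactPlus {S : Type*} [CommRing S] (φ : R →+* S) (q : R) (a : ℕ) :
    φ (qFactPlus q a) = qFactPlus (φ q) a := by
  simp [qFactPlus, map_prod]

/-- The generating polynomial of anti-lecture hall compositions with first entry at most `k` and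
at most `M` nonzero entries. -/
def alhGenFun (q : R) : ℕ → ℕ → R
  | 0 => fun _ => 1
  | k + 1 => fun M => ∑ p ∈ antidiagonal M,
      q ^ ((p.1 + 1).choose 2) * alhGenFun q k p.1 * gaussBinom q p.1 p.2

lemma map_alhGenFun {S : Type*} [CommRing S] (φ : R →+* S) (q : R) (k M : ℕ) :
    φ (alhGenFun q k M) = alhGenFun (φ q) k M := by
  induction k generalizing M with
  | zero => simp [alhGenFun]
  | succ k ih => simp [alhGenFun, ih, map_gaussBinom]

section Field

variable {K : Type*} [Field K] {q : K}

lemma gaussBinom_eq_div (hq : ∀ n, q ^ (n + 1) ≠ 1) (a b : ℕ) :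
    gaussBinom q a b = qFact q (a + b) / (qFact q a * qFact q b) := by
  rw [eq_div_iff (mul_ne_zero (qFact_ne_zero hq a) (qFact_ne_zero hq b)), gaussBinom_mul_qFact]

/-- One step `x ↦ ∑ q^(N(N+1)/2) x_N / (q)_{M-N}` of the chain for anti-lecture hall
compositions. -/
def triStep (q : K) (x : ℕ → K) (M : ℕ) : K :=
  ∑ p ∈ antidiagonal M, q ^ ((p.1 + 1).choose 2) * x p.1 / qFact q p.2

lemma alhGenFun_succ_div (hq : ∀ n, q ^ (n + 1) ≠ 1) (k M : ℕ) :
    alhGenFun q (k + 1) M / qFact q M =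
      triStep q (fun N => alhGenFun q k N / qFact q N) M := by
  rw [div_eq_iff (qFact_ne_zero hq M), triStep, sum_mul, alhGenFun]
  refine sum_congr rfl fun p hp => ?_
  rw [gaussBinom_eq_div hq, mem_antidiagonal.1 hp]
  have h1 := qFact_ne_zero hq p.1
  have h2 := qFact_ne_zero hq p.2
  field_simp

lemma choose_two_add (r j : ℕ) :
    (r + j + 1).choose 2 = (r + 1).choose 2 + j.choose 2 + (r + 1) * j := by
  induction j with
  | zero => simp
  | succ j ih =>
    rw [← add_assoc, Nat.choose_succ_succ' (r + j + 1) 1, Nat.choose_succ_succ' j 1, ih]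
    simp only [Nat.choose_one_right]
    ring

lemma sum_qFactPlus_kernel (hq : ∀ n, q ^ (n + 1) ≠ 1) (r L : ℕ) :
    (∑ s ∈ antidiagonal L, q ^ ((r + s.1 + 1).choose 2) / (qFact q s.1 * qFact q s.2)) *
      qFactPlus q r = q ^ ((r + 1).choose 2) * qFactPlus q (r + L) / qFact q L := by
  have h := prod_one_add_mul_pow q (q ^ (r + 1)) L
  rw [eq_div_iff (qFact_ne_zero hq L), qFactPlus, qFactPlus, prod_range_add]
  have h' : ∏ i ∈ range L, (1 + q ^ (r + i + 1)) = ∏ i ∈ range L, (1 + q ^ (r + 1) * q ^ i) :=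
    prod_congr rfl fun i _ => by ring
  rw [h', h, sum_mul, sum_mul, mul_sum, mul_sum]
  refine sum_congr rfl fun s hs => ?_
  rw [gaussBinom_eq_div hq, mem_antidiagonal.1 hs, choose_two_add]
  have h1 := qFact_ne_zero hq s.1
  have h2 := qFact_ne_zero hq s.2
  field_simp
  ring

lemma triStep_triStep_qFactPlus (hq : ∀ n, q ^ (n + 1) ≠ 1) (x : ℕ → K) (M : ℕ) :
    triStep q (triStep q fun N => qFactPlus q N * x N) M =
      qFactPlus q M * ∑ p ∈ antidiagonal M, q ^ (p.1 * (p.1 + 1)) * x p.1 / qFact q p.2 := by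
  have h := sum_antidiagonal_antidiagonal_assoc (fun r i j => q ^ ((r + i + 1).choose 2) *
    (q ^ ((r + 1).choose 2) * (qFactPlus q r * x r) / qFact q i) / qFact q j) M
  have h1 : triStep q (triStep q fun N => qFactPlus q N * x N) M =
      ∑ p ∈ antidiagonal M, ∑ s ∈ antidiagonal p.1, q ^ ((s.1 + s.2 + 1).choose 2) *
        (q ^ ((s.1 + 1).choose 2) * (qFactPlus q s.1 * x s.1) / qFact q s.2) / qFact q p.2 := by
    rw [triStep]
    refine sum_congr rfl fun p _ => ?_
    rw [triStep, mul_sum, sum_div]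
    refine sum_congr rfl fun s hs => ?_
    rw [mem_antidiagonal.1 hs]
  rw [h1, h, mul_sum]
  refine sum_congr rfl fun p hp => ?_
  have h2 := sum_qFactPlus_kernel hq p.1 p.2
  rw [mem_antidiagonal.1 hp] at h2
  calc _ = ((∑ s ∈ antidiagonal p.2,
        q ^ ((p.1 + s.1 + 1).choose 2) / (qFact q s.1 * qFact q s.2)) * qFactPlus q p.1) *
          (q ^ ((p.1 + 1).choose 2) * x p.1) := by
        rw [sum_mul, sum_mul]
        refine sum_congr rfl fun s _ => ?_
        have h1 := qFact_ne_zero hq s.1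
        have h2 := qFact_ne_zero hq s.2
        field_simp
    _ = _ := by
        have h3 : p.1 * (p.1 + 1) = (p.1 + 1).choose 2 + (p.1 + 1).choose 2 := by
          have := Nat.triangle_succ p.1
          have h4 := Nat.div_mul_cancel (Nat.even_mul_succ_self p.1).two_dvd
          rw [Nat.choose_two_right, Nat.add_sub_cancel, mul_comm (p.1 + 1)]
          omega
        rw [h2, h3, pow_add]
        have h1 := qFact_ne_zero hq p.2
        field_simp

lemma sum_pow_div_qFact (hq : ∀ n, q ^ (n + 1) ≠ 1) (c L : ℕ) :
    ∑ s ∈ antidiagonal L, q ^ (s.1 * (s.1 + c)) * gaussBinom q s.1 s.2 / qFact q (c + s.1) =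
      1 / qFact q (c + L) := by
  induction L generalizing c with
  | zero => simp
  | succ L ih =>
    have h := sum_antidiagonal_succ_mul_gaussBinom q
      (fun i j => q ^ (i * (i + c)) / qFact q (c + i)) L
    have h' := ih (c + 1)
    rw [show c + (L + 1) = c + 1 + L by ring, ← h']
    calc _ = _ := sum_congr rfl fun s _ => by rw [mul_div_right_comm]
      _ = _ := h
      _ = _ := sum_congr rfl fun s _ => by
        have h1 := qFact_ne_zero hq (c + s.1)
        have h2 : 1 - q ^ (c + s.1 + 1) ≠ 0 := sub_ne_zero.2 (hq _).symm
        rw [show c + (s.1 + 1) = c + s.1 + 1 by ring, show c + 1 + s.1 = c + s.1 + 1 by ring,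
          qFact_succ]
        field_simp
        ring

lemma bailey_kernel (hq : ∀ n, q ^ (n + 1) ≠ 1) (r L : ℕ) :
    ∑ s ∈ antidiagonal L, q ^ ((r + s.1) * (r + s.1 + 1)) /
      (qFact q s.1 * qFact q (2 * r + s.1 + 1) * qFact q s.2) =
      q ^ (r * (r + 1)) / (qFact q L * qFact q (2 * r + L + 1)) := by
  have h := sum_pow_div_qFact hq (2 * r + 1) L
  have hL := qFact_ne_zero hq L
  rw [show 2 * r + L + 1 = 2 * r + 1 + L by ring,
    show q ^ (r * (r + 1)) / (qFact q L * qFact q (2 * r + 1 + L)) =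
      q ^ (r * (r + 1)) / qFact q L * (1 / qFact q (2 * r + 1 + L)) by field_simp, ← h, mul_sum]
  refine sum_congr rfl fun s hs => ?_
  rw [gaussBinom_eq_div hq, mem_antidiagonal.1 hs, show 2 * r + s.1 + 1 = 2 * r + 1 + s.1 by ring]
  have h1 := qFact_ne_zero hq s.1
  have h2 := qFact_ne_zero hq s.2
  have h3 := qFact_ne_zero hq (2 * r + 1 + s.1)
  field_simp
  ring

/-- The member `β` of the Bailey pair relative to `q` obtained from the unit pair by `m` steps
of the Bailey chain. -/
def baileyBeta (q : K) (m M : ℕ) : K :=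
  ∑ p ∈ antidiagonal M, (-1) ^ p.1 * q ^ (p.1.choose 2 + m * (p.1 * (p.1 + 1))) *
    (1 - q ^ (2 * p.1 + 1)) / (qFact q p.2 * qFact q (2 * p.1 + p.2 + 1))

lemma baileyBeta_succ (hq : ∀ n, q ^ (n + 1) ≠ 1) (m M : ℕ) :
    baileyBeta q (m + 1) M =
      ∑ p ∈ antidiagonal M, q ^ (p.1 * (p.1 + 1)) * baileyBeta q m p.1 / qFact q p.2 := by
  have h := sum_antidiagonal_antidiagonal_assoc (fun r i j => q ^ ((r + i) * (r + i + 1)) *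
    ((-1) ^ r * q ^ (r.choose 2 + m * (r * (r + 1))) *
    (1 - q ^ (2 * r + 1)) / (qFact q i * qFact q (2 * r + i + 1))) / qFact q j) M
  have h1 : ∑ p ∈ antidiagonal M, q ^ (p.1 * (p.1 + 1)) * baileyBeta q m p.1 / qFact q p.2 =
      ∑ p ∈ antidiagonal M, ∑ s ∈ antidiagonal p.1, q ^ ((s.1 + s.2) * (s.1 + s.2 + 1)) *
    ((-1) ^ s.1 * q ^ (s.1.choose 2 + m * (s.1 * (s.1 + 1))) *
    (1 - q ^ (2 * s.1 + 1)) / (qFact q s.2 * qFact q (2 * s.1 + s.2 + 1))) / qFact q p.2 := by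
    refine sum_congr rfl fun p _ => ?_
    rw [baileyBeta, mul_sum, sum_div]
    refine sum_congr rfl fun s hs => ?_
    rw [mem_antidiagonal.1 hs]
  rw [h1, h, baileyBeta]
  refine sum_congr rfl fun p _ => ?_
  calc _ = (-1) ^ p.1 * q ^ (p.1.choose 2 + m * (p.1 * (p.1 + 1))) * (1 - q ^ (2 * p.1 + 1)) *
        (q ^ (p.1 * (p.1 + 1)) / (qFact q p.2 * qFact q (2 * p.1 + p.2 + 1))) := by ring
    _ = _ := by
      rw [← bailey_kernel hq, mul_sum]
      refine sum_congr rfl fun s _ => ?_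
      have h1 := qFact_ne_zero hq s.1
      have h2 := qFact_ne_zero hq s.2
      have h3 := qFact_ne_zero hq (2 * p.1 + s.1 + 1)
      field_simp

lemma baileyBeta_zero (hq : ∀ n, q ^ (n + 1) ≠ 1) (M : ℕ) :
    baileyBeta q 0 M = if M = 0 then 1 else 0 := by
  have hq1 : 1 - q ≠ 0 := sub_ne_zero.2 (by simpa using (hq 0).symm)
  rcases M with _ | M
  · simp [baileyBeta, qFact, hq1]
  · have h := prod_mul_prod_succ_eq_sum (z := q) (w := 1) (by simpa using hq) (M + 1)
    rw [prod_range_succ', mul_comm] at h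
    simp only [mul_one, one_mul, pow_zero, sub_self, mul_zero, one_pow] at h
    simp only [if_neg (Nat.succ_ne_zero M)]
    refine (mul_eq_zero.1 (?_ : baileyBeta q 0 (M + 1) * qFact q (2 * (M + 1) + 1) = 0)
      ).resolve_right
      (qFact_ne_zero hq _)
    rw [h, baileyBeta, sum_mul]
    refine sum_congr rfl fun p hp => ?_
    rw [gaussBinom_eq_div hq, ← mem_antidiagonal.1 hp,
      show 2 * (p.1 + p.2) + 1 = p.2 + (2 * p.1 + p.2 + 1) by ring]
    ring

lemma alhGenFun_odd_div (hq : ∀ n, q ^ (n + 1) ≠ 1) (m M : ℕ) :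
    alhGenFun q (2 * m + 1) M / qFact q M = qFactPlus q M * baileyBeta q (m + 1) M := by
  induction m generalizing M with
  | zero =>
    have h0 : (fun N => alhGenFun q 0 N / qFact q N) =
        triStep q fun N => qFactPlus q N * baileyBeta q 0 N := by
      funext N
      rw [triStep, sum_eq_single (0, N)]
      · simp [alhGenFun, baileyBeta_zero hq, qFactPlus]
      · rintro ⟨a, b⟩ hp hne
        have : a ≠ 0 := by
          rintro rfl
          exact hne (by simpa using hp)
        simp [baileyBeta_zero hq, this]
      · simp
    rw [alhGenFun_succ_div hq, h0, triStep_triStep_qFactPlus hq, baileyBeta_succ hq]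
  | succ m ih =>
    rw [show 2 * (m + 1) + 1 = (2 * m + 1 + 1) + 1 by ring, alhGenFun_succ_div hq]
    have h1 : (fun N => alhGenFun q (2 * m + 1 + 1) N / qFact q N) =
        triStep q fun N => qFactPlus q N * baileyBeta q (m + 1) N := by
      funext N
      rw [alhGenFun_succ_div hq]
      simp only [ih]
    rw [h1, triStep_triStep_qFactPlus hq, baileyBeta_succ hq]

lemma alhGenFun_odd_mul_qFact (hq : ∀ n, q ^ (n + 1) ≠ 1) (m M : ℕ) :
    alhGenFun q (2 * m + 1) M * qFact q (2 * M + 1) = qFactPlus q M * qFact q M *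
      ∑ p ∈ antidiagonal M, (-1) ^ p.1 * q ^ (p.1.choose 2 + (m + 1) * (p.1 * (p.1 + 1))) *
        (1 - q ^ (2 * p.1 + 1)) * gaussBinom q p.2 (2 * p.1 + p.2 + 1) := by
  rw [(div_eq_iff (qFact_ne_zero hq M)).1 (alhGenFun_odd_div hq m M), baileyBeta,
    mul_assoc, mul_assoc, mul_assoc, mul_left_comm _ (qFact q M), ← mul_assoc, ← mul_assoc,
    mul_assoc, mul_assoc, sum_mul]
  congr 2
  refine sum_congr rfl fun p hp => ?_
  rw [gaussBinom_eq_div hq, ← mem_antidiagonal.1 hp,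
    show 2 * (p.1 + p.2) + 1 = p.2 + (2 * p.1 + p.2 + 1) by ring]
  ring

end Field

end qSeries

section Compositions

open Finset

lemma finite_bounded_functions (b C : ℕ) :
    {g : ℕ → ℕ | (∀ i, g i ≤ C) ∧ ∀ i, b ≤ i → g i = 0}.Finite := by
  refine ((Set.finite_univ (α := Fin b → Fin (C + 1))).image
    fun h i => if hi : i < b then (h ⟨i, hi⟩ : ℕ) else 0).subset ?_
  rintro g ⟨h1, h2⟩
  refine ⟨fun i => ⟨g i, Nat.lt_succ_of_le (h1 i)⟩, trivial, ?_⟩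
  funext i
  by_cases hi : i < b
  · simp [hi]
  · simp [hi, h2 i (not_lt.1 hi)]

/-- Partitions fitting in a box: weakly decreasing sequences with at most `b` nonzero entries,
all at most `a`. -/
def boxSet (a b : ℕ) : Set (ℕ → ℕ) := {g | Antitone g ∧ g 0 ≤ a ∧ ∀ i, b ≤ i → g i = 0}

lemma boxSet_finite (a b : ℕ) : (boxSet a b).Finite :=
  (finite_bounded_functions b a).subset fun _ hg =>
    ⟨fun i => (hg.1 (Nat.zero_le i)).trans hg.2.1, hg.2.2⟩

/-- `boxSet a b` as a finset. -/
noncomputable def boxFinset (a b : ℕ) : Finset (ℕ → ℕ) := (boxSet_finite a b).toFinset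

lemma mem_boxFinset {a b : ℕ} {g : ℕ → ℕ} :
    g ∈ boxFinset a b ↔ Antitone g ∧ g 0 ≤ a ∧ ∀ i, b ≤ i → g i = 0 := by
  simp [boxFinset, boxSet]

lemma boxFinset_eq_singleton {a b : ℕ} (h : a = 0 ∨ b = 0) : boxFinset a b = {0} := by
  ext g
  rw [mem_boxFinset, mem_singleton]
  constructor
  · rintro ⟨h1, h2, h3⟩
    funext i
    rcases h with rfl | rfl
    · exact Nat.le_zero.1 ((h1 (Nat.zero_le i)).trans h2)
    · exact h3 i (Nat.zero_le i)
  · rintro rfl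
    exact ⟨antitone_const, by simp, by simp⟩

/-- The sequence `a, g 0, g 1, …`. -/
def prepend (a : ℕ) (g : ℕ → ℕ) : ℕ → ℕ
  | 0 => a
  | i + 1 => g i

lemma sum_boxFinset {R : Type*} [CommRing R] (q : R) (a b : ℕ) :
    ∑ g ∈ boxFinset a b, q ^ (∑ i ∈ range b, g i) = gaussBinom q a b := by
  classical
  induction a generalizing b with
  | zero => simp [boxFinset_eq_singleton]
  | succ a iha =>
    induction b with
    | zero => simp [boxFinset_eq_singleton]
    | succ b ihb =>
      have hinj : Function.Injective (prepend (a + 1)) := by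
        intro g g' h
        funext i
        exact congrFun h (i + 1)
      have hunion : boxFinset (a + 1) (b + 1) = boxFinset a (b + 1) ∪
          (boxFinset (a + 1) b).image (prepend (a + 1)) := by
        ext g
        simp only [mem_union, mem_image, mem_boxFinset]
        constructor
        · rintro ⟨h1, h2, h3⟩
          rcases Nat.lt_or_ge a (g 0) with h | h
          · refine Or.inr ⟨fun i => g (i + 1), ⟨fun i j hij => h1 (by omega),
              (h1 (Nat.zero_le _)).trans h2, fun i hi => h3 _ (by omega)⟩, ?_⟩
            funext i
            cases i
            · exact le_antisymm h h2
            · rfl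
          · exact Or.inl ⟨h1, h, h3⟩
        · rintro (⟨h1, h2, h3⟩ | ⟨g, ⟨h1, h2, h3⟩, rfl⟩)
          · exact ⟨h1, h2.trans (Nat.le_succ a), h3⟩
          · refine ⟨antitone_nat_of_succ_le fun i => ?_, le_rfl, fun i hi => ?_⟩
            · cases i
              · exact h2
              · exact h1 (Nat.le_succ _)
            · cases i
              · omega
              · exact h3 _ (by omega)
      have hdisj : Disjoint (boxFinset a (b + 1))
          ((boxFinset (a + 1) b).image (prepend (a + 1))) := by
        rw [disjoint_left]
        rintro _ h h'
        obtain ⟨g, -, rfl⟩ := mem_image.1 h'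
        exact absurd (mem_boxFinset.1 h).2.1 (by simp [prepend])
      rw [hunion, sum_union hdisj, sum_image hinj.injOn, iha, gaussBinom_succ_succ, ← ihb, mul_sum]
      congr 1
      refine sum_congr rfl fun g _ => ?_
      rw [sum_range_succ', pow_add, mul_comm]
      rfl

/-- Anti-lecture hall compositions with first entry at most `k` and at most `M` nonzero entries. -/
def alhSet (k M : ℕ) : Set (ℕ → ℕ) :=
  {f | (∀ i, (i + 1) * f (i + 1) ≤ (i + 2) * f i) ∧ f 0 ≤ k ∧ ∀ i, M ≤ i → f i = 0}

lemma alh_le_mul {f : ℕ → ℕ} (h : ∀ i, (i + 1) * f (i + 1) ≤ (i + 2) * f i) (i : ℕ) :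
    f i ≤ (i + 1) * f 0 := by
  induction i with
  | zero => simp
  | succ i ih =>
    have := h i
    refine Nat.le_of_mul_le_mul_left (this.trans ?_) (Nat.succ_pos i)
    calc (i + 2) * f i ≤ (i + 2) * ((i + 1) * f 0) := Nat.mul_le_mul_left _ ih
      _ = (i + 1) * ((i + 1 + 1) * f 0) := by ring

lemma alhSet_finite (k M : ℕ) : (alhSet k M).Finite := by
  refine (finite_bounded_functions M (M * k)).subset ?_
  rintro f ⟨h1, h2, h3⟩
  refine ⟨fun i => ?_, h3⟩
  rcases Nat.lt_or_ge i M with hi | hi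
  · exact (alh_le_mul h1 i).trans (Nat.mul_le_mul hi h2)
  · simp [h3 i hi]

/-- `alhSet k M` as a finset. -/
noncomputable def alhFinset (k M : ℕ) : Finset (ℕ → ℕ) := (alhSet_finite k M).toFinset

lemma mem_alhFinset {k M : ℕ} {f : ℕ → ℕ} : f ∈ alhFinset k M ↔
    (∀ i, (i + 1) * f (i + 1) ≤ (i + 2) * f i) ∧ f 0 ≤ k ∧ ∀ i, M ≤ i → f i = 0 := by
  simp [alhFinset, alhSet]

/-- The first (zero-based) position `i` at which `f i < i + 1`. -/
noncomputable def firstSmall (f : ℕ → ℕ) : ℕ := sInf {i | f i ≤ i}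

lemma lt_of_lt_firstSmall {f : ℕ → ℕ} {i : ℕ} (h : i < firstSmall f) : i < f i :=
  not_le.1 (Nat.notMem_of_lt_sInf (s := {i | f i ≤ i}) h)

lemma le_of_firstSmall_le {f : ℕ → ℕ} (hf : ∀ i, (i + 1) * f (i + 1) ≤ (i + 2) * f i) {M : ℕ}
    (hM : f M = 0) {i : ℕ} (h : firstSmall f ≤ i) : f i ≤ i := by
  induction i, h using Nat.le_induction with
  | base => exact Nat.sInf_mem (s := {i | f i ≤ i}) ⟨M, by simp [hM]⟩
  | succ i _ ih =>
    refine Nat.le_of_mul_le_mul_left ((hf i).trans ?_) (Nat.succ_pos i)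
    nlinarith

lemma firstSmall_eq {f : ℕ → ℕ} {N : ℕ} (h1 : ∀ i < N, i < f i) (h2 : f N ≤ N) :
    firstSmall f = N := by
  refine le_antisymm (Nat.sInf_le h2) (le_csInf ⟨N, h2⟩ fun i hi => ?_)
  by_contra hlt
  exact absurd (h1 i (not_le.1 hlt)) (not_lt.2 hi)

/-- Add the staircase `1, 2, …, N` to the first `N` entries of `g` and append `h`. -/
def glue (N : ℕ) (g h : ℕ → ℕ) (i : ℕ) : ℕ := if i < N then g i + (i + 1) else h (i - N)

lemma glue_mem {k N l : ℕ} {g h : ℕ → ℕ} (hg : g ∈ alhFinset k N) (hh : h ∈ boxFinset N l) :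
    glue N g h ∈ alhFinset (k + 1) (N + l) := by
  rw [mem_alhFinset] at *
  rw [mem_boxFinset] at hh
  obtain ⟨g1, g2, g3⟩ := hg
  obtain ⟨h1, h2, h3⟩ := hh
  refine ⟨fun i => ?_, ?_, fun i hi => ?_⟩
  · have hgi := g1 i
    rcases lt_trichotomy (i + 1) N with hi | hi | hi
    · simp only [glue, if_pos hi, if_pos (Nat.lt_of_succ_lt hi)]
      nlinarith
    · subst hi
      simp only [glue, lt_irrefl, if_false, if_pos (Nat.lt_succ_self i), Nat.sub_self]
      nlinarith
    · simp only [glue, if_neg (not_lt.2 hi.le), if_neg (not_lt.2 (Nat.lt_succ_iff.1 hi))]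
      exact Nat.mul_le_mul (Nat.le_succ _) (h1 (by omega))
  · unfold glue
    split_ifs with h
    · omega
    · have : N = 0 := by omega
      simp only [Nat.zero_sub]
      omega
  · rw [glue, if_neg (by omega)]
    exact h3 _ (by omega)

lemma firstSmall_glue {N l : ℕ} {g h : ℕ → ℕ} (hh : h ∈ boxFinset N l) :
    firstSmall (glue N g h) = N := by
  refine firstSmall_eq (fun i hi => ?_) ?_
  · rw [glue, if_pos hi]
    omega
  · rw [glue, if_neg (lt_irrefl N), Nat.sub_self]
    exact (mem_boxFinset.1 hh).2.1

lemma firstSmall_le {k M : ℕ} {f : ℕ → ℕ} (hf : f ∈ alhFinset k M) : firstSmall f ≤ M :=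
  Nat.sInf_le (by simp [(mem_alhFinset.1 hf).2.2 M le_rfl])

lemma head_mem {k M : ℕ} {f : ℕ → ℕ} (hf : f ∈ alhFinset (k + 1) M) :
    (fun i => if i < firstSmall f then f i - (i + 1) else 0) ∈ alhFinset k (firstSmall f) := by
  rw [mem_alhFinset] at *
  obtain ⟨h1, h2, h3⟩ := hf
  refine ⟨fun i => ?_, ?_, fun i hi => if_neg (not_lt.2 hi)⟩
  · by_cases hi : i + 1 < firstSmall f
    · rw [if_pos hi, if_pos (Nat.lt_of_succ_lt hi)]
      obtain ⟨a, ha⟩ := Nat.exists_eq_add_of_le (Nat.succ_le_of_lt (lt_of_lt_firstSmall hi))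
      obtain ⟨b, hb⟩ := Nat.exists_eq_add_of_le
        (Nat.succ_le_of_lt (lt_of_lt_firstSmall (Nat.lt_of_succ_lt hi)))
      have := h1 i
      rw [ha, hb] at this ⊢
      simp only [Nat.succ_eq_add_one, Nat.add_sub_cancel_left]
      nlinarith
    · simp [if_neg hi]
  · split_ifs <;> omega

lemma tail_mem {k M : ℕ} {f : ℕ → ℕ} (hf : f ∈ alhFinset k M) :
    (fun i => f (firstSmall f + i)) ∈ boxFinset (firstSmall f) (M - firstSmall f) := by
  have hle := firstSmall_le hf
  rw [mem_alhFinset] at hf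
  obtain ⟨h1, h2, h3⟩ := hf
  have hsmall : ∀ i, firstSmall f ≤ i → f i ≤ i := fun i =>
    le_of_firstSmall_le h1 (h3 M le_rfl)
  rw [mem_boxFinset]
  refine ⟨antitone_nat_of_succ_le fun i => ?_, hsmall _ le_rfl, fun i hi => h3 _ (by omega)⟩
  have hi := hsmall (firstSmall f + i) (Nat.le_add_right _ _)
  have := h1 (firstSmall f + i)
  rw [← add_assoc]
  by_contra! hlt
  nlinarith

lemma glue_firstSmall (f : ℕ → ℕ) :
    glue (firstSmall f) (fun i => if i < firstSmall f then f i - (i + 1) else 0)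
      (fun i => f (firstSmall f + i)) = f := by
  funext i
  unfold glue
  split_ifs with hi
  · have := lt_of_lt_firstSmall hi
    simp only [if_pos hi]
    omega
  · dsimp only
    rw [Nat.add_sub_of_le (not_lt.1 hi)]

lemma sum_glue (N l : ℕ) (g h : ℕ → ℕ) : ∑ i ∈ range (N + l), glue N g h i =
    (N + 1).choose 2 + ∑ i ∈ range N, g i + ∑ i ∈ range l, h i := by
  rw [sum_range_add]
  congr 1
  · have hN : (N + 1).choose 2 = ∑ i ∈ range N, (i + 1) := by
      clear g h
      induction N with
      | zero => rfl
      | succ N ih =>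
        rw [sum_range_succ, ← ih, Nat.choose_succ_succ', Nat.choose_one_right, add_comm]
    rw [hN, add_comm, ← sum_add_distrib]
    exact sum_congr rfl fun i hi => if_pos (mem_range.1 hi)
  · refine sum_congr rfl fun i _ => ?_
    simp [glue]

lemma sum_alhFinset {R : Type*} [CommRing R] (q : R) (k M : ℕ) :
    ∑ f ∈ alhFinset k M, q ^ (∑ i ∈ range M, f i) = alhGenFun q k M := by
  induction k generalizing M with
  | zero =>
    have h : alhFinset 0 M = {0} := by
      ext f
      rw [mem_alhFinset, mem_singleton]
      constructor
      · rintro ⟨h1, h2, h3⟩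
        funext i
        simpa [Nat.le_zero.1 h2] using alh_le_mul h1 i
      · rintro rfl
        simp
    simp [h, alhGenFun]
  | succ k ih =>
    have h : ∀ p : ℕ × ℕ,
        q ^ ((p.1 + 1).choose 2) * alhGenFun q k p.1 * gaussBinom q p.1 p.2 =
        ∑ x ∈ alhFinset k p.1 ×ˢ boxFinset p.1 p.2,
          q ^ ((p.1 + 1).choose 2 + ∑ i ∈ range p.1, x.1 i + ∑ i ∈ range p.2, x.2 i) := by
      intro p
      rw [← ih, ← sum_boxFinset, mul_assoc, sum_mul_sum, mul_sum, sum_product]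
      refine sum_congr rfl fun g _ => ?_
      rw [mul_sum]
      refine sum_congr rfl fun h _ => ?_
      ring
    rw [alhGenFun]
    simp only [h]
    rw [sum_sigma']
    refine sum_bij' (fun f _ => ⟨(firstSmall f, M - firstSmall f),
        (fun i => if i < firstSmall f then f i - (i + 1) else 0, fun i => f (firstSmall f + i))⟩)
      (fun x _ => glue x.1.1 x.2.1 x.2.2) ?_ ?_ ?_ ?_ ?_
    · intro f hf
      simp only [mem_sigma, HasAntidiagonal.mem_antidiagonal, mem_product]
      exact ⟨Nat.add_sub_of_le (firstSmall_le hf), head_mem hf, tail_mem hf⟩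
    · rintro ⟨⟨N, l⟩, g, h⟩ hx
      simp only [mem_sigma, HasAntidiagonal.mem_antidiagonal, mem_product] at hx
      obtain ⟨rfl, hg, hh⟩ := hx
      exact glue_mem hg hh
    · exact fun f _ => glue_firstSmall f
    · rintro ⟨⟨N, l⟩, g, h⟩ hx
      simp only [mem_sigma, HasAntidiagonal.mem_antidiagonal, mem_product] at hx
      obtain ⟨rfl, hg, hh⟩ := hx
      simp only [firstSmall_glue hh, Nat.add_sub_cancel_left]
      congr 2
      · funext i
        split_ifs with hi
        · simp [glue, hi]
        · exact ((mem_alhFinset.1 hg).2.2 i (not_lt.1 hi)).symm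
      · funext i
        simp [glue]
    · intro f hf
      have := sum_glue (firstSmall f) (M - firstSmall f)
        (fun i => if i < firstSmall f then f i - (i + 1) else 0) fun i => f (firstSmall f + i)
      rw [Nat.add_sub_of_le (firstSmall_le hf), glue_firstSmall] at this
      rw [this]

end Compositions

section Counting

open Finset PowerSeries

lemma sum_range_eq_wt {f : ℕ → ℕ} {M : ℕ} (hf : ∀ i, M ≤ i → f i = 0) :
    ∑ i ∈ range M, f i = wt f := by
  refine (finsum_eq_sum_of_support_subset f fun i hi => ?_).symm
  rw [coe_range, Set.mem_Iio]
  by_contra! h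
  exact hi (hf i h)

lemma IsALH.eq_zero_of_wt_le {f : ℕ → ℕ} (hf : IsALH f) {i : ℕ} (hi : wt f ≤ i) : f i = 0 := by
  by_contra h
  have hpos : ∀ j ≤ i, 1 ≤ f j := by
    intro j hj
    induction hj using Nat.decreasingInduction with
    | self => exact Nat.one_le_iff_ne_zero.2 h
    | of_succ j _ ih =>
      by_contra! h0
      have := hf.2 j
      rw [Nat.lt_one_iff.1 h0] at this
      nlinarith
  have hsum : ∑ j ∈ range (i + 1), f j ≤ wt f := by
    rw [wt, finsum_eq_sum_of_support_subset (s := hf.1.toFinset ∪ range (i + 1)) f (by simp)]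
    exact sum_le_sum_of_subset subset_union_right
  have hcard : ∑ j ∈ range (i + 1), 1 ≤ ∑ j ∈ range (i + 1), f j :=
    sum_le_sum fun j hj => hpos j (Nat.lt_succ_iff.1 (mem_range.1 hj))
  have := hcard.trans hsum
  simp only [sum_const, card_range, smul_eq_mul, mul_one] at this
  omega

lemma ncard_Fset {k n M : ℕ} (h : n ≤ M) :
    ((Fset k n).ncard : ℤ) = coeff n (alhGenFun (X : ℤ⟦X⟧) k M) := by
  have hF : Fset k n = ((alhFinset k M).filter fun f => n = ∑ i ∈ range M, f i : Set (ℕ → ℕ)) := by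
    ext f
    simp only [Fset, Set.mem_ofPred_eq, coe_filter, mem_alhFinset]
    constructor
    · rintro ⟨h1, h2, rfl⟩
      have h3 : ∀ i, M ≤ i → f i = 0 := fun i hi => h1.eq_zero_of_wt_le (h.trans hi)
      exact ⟨⟨h1.2, h2, h3⟩, (sum_range_eq_wt h3).symm⟩
    · rintro ⟨⟨h1, h2, h3⟩, rfl⟩
      refine ⟨⟨(Set.finite_lt_nat M).subset fun i hi => ?_, h1⟩, h2, (sum_range_eq_wt h3).symm⟩
      by_contra hi'
      exact hi (h3 i (not_lt.1 hi'))
  rw [hF, Set.ncard_coe_finset, ← sum_alhFinset, map_sum, card_filter]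
  simp [coeff_X_pow]

lemma ncard_Hset (t n : ℕ) : (Hset t n).ncard = ∑ p ∈ antidiagonal n,
    #(Nat.Partition.distincts p.1) *
      #(Nat.Partition.restricted p.2 fun x => x % t ≠ 0 ∧ x % t ≠ 1 ∧ x % t ≠ t - 1) := by
  simp only [← card_product]
  rw [← card_sigma, ← Set.ncard_coe_finset]
  symm
  refine Set.ncard_congr (fun x _ => (x.2.1.parts, x.2.2.parts)) ?_ ?_ ?_
  · rintro ⟨⟨a, b⟩, μ, ν⟩ h
    simp only [coe_sigma, Set.mem_sigma_iff, mem_coe, HasAntidiagonal.mem_antidiagonal,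
      mem_product, Nat.Partition.distincts, Nat.Partition.restricted, mem_filter, mem_univ,
      true_and] at h
    obtain ⟨rfl, h1, h2⟩ := h
    exact ⟨h1, fun x hx => μ.parts_pos hx, fun x hx => ⟨ν.parts_pos hx, h2 x hx⟩,
      by rw [μ.parts_sum, ν.parts_sum]⟩
  · rintro ⟨⟨a, b⟩, μ, ν⟩ ⟨⟨c, d⟩, μ', ν'⟩ - - h
    simp only [Prod.mk.injEq] at h
    obtain ⟨h1, h2⟩ := h
    obtain rfl : a = c := μ.parts_sum.symm.trans ((congrArg _ h1).trans μ'.parts_sum)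
    obtain rfl : b = d := ν.parts_sum.symm.trans ((congrArg _ h2).trans ν'.parts_sum)
    rw [Nat.Partition.ext h1, Nat.Partition.ext h2]
  · rintro ⟨μ, ν⟩ ⟨h1, h2, h3, h4⟩
    refine ⟨⟨(μ.sum, ν.sum), ⟨μ, fun {x} hx => h2 x hx, rfl⟩,
      ⟨ν, fun {x} hx => (h3 x hx).1, rfl⟩⟩, ?_, rfl⟩
    simp only [coe_sigma, Set.mem_sigma_iff, mem_coe, HasAntidiagonal.mem_antidiagonal,
      mem_product, Nat.Partition.distincts, Nat.Partition.restricted, mem_filter, mem_univ,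
      true_and]
    exact ⟨h4, h1, fun x hx => (h3 x hx).2⟩

lemma ncard_Hset_eq_coeff (t n : ℕ) : ((Hset t n).ncard : ℤ) = coeff n
    ((PowerSeries.mk fun a => (#(Nat.Partition.countRestricted a 2) : ℤ)) *
      PowerSeries.mk fun b => (#(Nat.Partition.restricted b
        fun x => x % t ≠ 0 ∧ x % t ≠ 1 ∧ x % t ≠ t - 1) : ℤ)) := by
  rw [ncard_Hset, coeff_mul]
  simp [Nat.Partition.countRestricted_two]

end Counting

section Nilpotent

open Finset

variable {R : Type*} [CommRing R] {q : R} {n : ℕ}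

lemma qFact_eq_of_pow_eq_zero (hq : q ^ (n + 1) = 0) {L : ℕ} (hL : n ≤ L) :
    qFact q L = qFact q n := by
  induction L, hL using Nat.le_induction with
  | base => rfl
  | succ L hL ih => rw [qFact_succ, ih, pow_eq_zero_of_le (by omega) hq, sub_zero, mul_one]

lemma isUnit_qFact_of_pow_eq_zero (hq : q ^ (n + 1) = 0) (L : ℕ) : IsUnit (qFact q L) := by
  induction L with
  | zero => simp [qFact_zero]
  | succ L ih =>
    rw [qFact_succ]
    have hnil : IsNilpotent q := ⟨_, hq⟩
    exact ih.mul (hnil.pow_succ L).isUnit_one_sub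

lemma gaussBinom_mul_qFact_of_pow_eq_zero (hq : q ^ (n + 1) = 0) {a b : ℕ} (ha : n ≤ a)
    (hb : n ≤ b) : gaussBinom q a b * qFact q n = 1 := by
  have h := gaussBinom_mul_qFact q a b
  rw [qFact_eq_of_pow_eq_zero hq ha, qFact_eq_of_pow_eq_zero hq hb,
    qFact_eq_of_pow_eq_zero hq (ha.trans (Nat.le_add_right a b)), ← mul_assoc] at h
  exact (isUnit_qFact_of_pow_eq_zero hq n).mul_eq_right.1 h

lemma sum_mul_gaussBinom_mul_qFact_of_pow_eq_zero (hq : q ^ (n + 1) = 0) {c : ℕ → R}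
    (hc : ∀ r, n < r → c r = 0) {M : ℕ} (hM : 2 * n ≤ M) :
    (∑ p ∈ antidiagonal M, c p.1 * gaussBinom q p.2 (2 * p.1 + p.2 + 1)) * qFact q n =
      ∑ p ∈ antidiagonal M, c p.1 := by
  rw [sum_mul]
  refine sum_congr rfl fun p hp => ?_
  rw [HasAntidiagonal.mem_antidiagonal] at hp
  rcases Nat.lt_or_ge n p.1 with h | h
  · simp [hc _ h]
  · rw [mul_assoc, gaussBinom_mul_qFact_of_pow_eq_zero hq (by omega) (by omega), mul_one]

lemma qFact_mul_eq_prod_residues (q : R) (m L : ℕ) : qFact q ((2 * m + 3) * L) =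
    (∏ i ∈ range ((2 * m + 3) * L), if (i + 1) % (2 * m + 3) ≠ 0 ∧ (i + 1) % (2 * m + 3) ≠ 1 ∧
        (i + 1) % (2 * m + 3) ≠ 2 * m + 3 - 1 then 1 - q ^ (i + 1) else 1) *
      ((∏ i ∈ range L, (1 - q ^ (2 * m + 2) * (q ^ (2 * m + 3)) ^ i)) *
        (∏ i ∈ range L, (1 - q * (q ^ (2 * m + 3)) ^ i)) * qFact (q ^ (2 * m + 3)) L) := by
  induction L with
  | zero => simp [qFact_zero]
  | succ L ih =>
    have hmid : ∏ i ∈ range (2 * m), (if ((2 * m + 3) * L + (i + 1) + 1) % (2 * m + 3) ≠ 0 ∧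
        ((2 * m + 3) * L + (i + 1) + 1) % (2 * m + 3) ≠ 1 ∧
        ((2 * m + 3) * L + (i + 1) + 1) % (2 * m + 3) ≠ 2 * m + 3 - 1 then
          1 - q ^ ((2 * m + 3) * L + (i + 1) + 1) else 1) =
        ∏ i ∈ range (2 * m), (1 - q ^ ((2 * m + 3) * L + (i + 1) + 1)) := by
      refine prod_congr rfl fun i hi => if_pos ?_
      rw [mem_range] at hi
      rw [add_assoc, Nat.mul_add_mod, Nat.mod_eq_of_lt (by omega)]
      omega
    have h0 : ((2 * m + 3) * L + 0 + 1) % (2 * m + 3) = 1 := by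
      rw [add_assoc, Nat.mul_add_mod, Nat.mod_eq_of_lt (by omega)]
    have h1 : ((2 * m + 3) * L + (2 * m + 1) + 1) % (2 * m + 3) = 2 * m + 3 - 1 := by
      rw [add_assoc, Nat.mul_add_mod, Nat.mod_eq_of_lt (by omega)]
      omega
    have h2 : ((2 * m + 3) * L + (2 * m + 2) + 1) % (2 * m + 3) = 0 := by
      rw [add_assoc, Nat.mul_add_mod, Nat.mod_self]
    have hsplit : ∀ f : ℕ → R, ∏ i ∈ range (2 * m + 3), f i =
        (∏ i ∈ range (2 * m), f (i + 1)) * f 0 * f (2 * m + 1) * f (2 * m + 2) := fun f => by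
      rw [prod_range_succ, prod_range_succ, prod_range_succ']
    rw [qFact] at ih ⊢
    rw [Nat.mul_succ, prod_range_add _ ((2 * m + 3) * L), ih, prod_range_add _ ((2 * m + 3) * L),
      hsplit, hsplit, prod_range_succ _ L, prod_range_succ _ L,
      qFact_succ, hmid, h0, h1, h2]
    simp only [ne_eq, not_true_eq_false, false_and, and_false, if_false]
    ring

end Nilpotent

section Limit

open Finset PowerSeries Filter

open scoped PowerSeries.WithPiTopology

lemma X_pow_succ_ne_one (n : ℕ) : (X : ℤ⟦X⟧) ^ (n + 1) ≠ 1 := by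
  intro h
  simpa using congrArg constantCoeff h

/-- The coefficients of the partial theta expansion satisfied by the odd anti-lecture hall
generating functions. -/
def partialTheta {R : Type*} [CommRing R] (q : R) (m r : ℕ) : R :=
  (-1) ^ r * q ^ (r.choose 2 + (m + 1) * (r * (r + 1))) * (1 - q ^ (2 * r + 1))

lemma map_partialTheta {R S : Type*} [CommRing R] [CommRing S] (φ : R →+* S) (q : R) (m r : ℕ) :
    φ (partialTheta q m r) = partialTheta (φ q) m r := by
  simp [partialTheta]

lemma partialTheta_eq_zero {R : Type*} [CommRing R] {q : R} {n : ℕ} (hq : q ^ (n + 1) = 0)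
    (m : ℕ) {r : ℕ} (hr : n < r) : partialTheta q m r = 0 := by
  rw [partialTheta, pow_eq_zero_of_le _ hq, mul_zero, zero_mul]
  calc n + 1 ≤ 1 * (r * 1) := by omega
    _ ≤ (m + 1) * (r * (r + 1)) := by gcongr <;> omega
    _ ≤ _ := Nat.le_add_left _ _

lemma alhGenFun_X_mul_qFact (m M : ℕ) :
    alhGenFun (X : ℤ⟦X⟧) (2 * m + 1) M * qFact X (2 * M + 1) = qFactPlus X M * qFact X M *
      ∑ p ∈ antidiagonal M, partialTheta X m p.1 * gaussBinom X p.2 (2 * p.1 + p.2 + 1) := by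
  have hinj := IsFractionRing.injective ℤ⟦X⟧ (FractionRing ℤ⟦X⟧)
  apply hinj
  simp only [map_mul, map_sum, map_alhGenFun, map_qFact, map_qFactPlus, map_partialTheta,
    map_gaussBinom]
  refine alhGenFun_odd_mul_qFact (fun n h => X_pow_succ_ne_one n (hinj ?_)) m M
  simpa using h

lemma prod_mul_prod_eq_sum_partialTheta (m M : ℕ) :
    (∏ i ∈ range M, (1 - X ^ (2 * m + 2) * (X ^ (2 * m + 3)) ^ i)) *
      ∏ i ∈ range (M + 1), (1 - X * ((X : ℤ⟦X⟧) ^ (2 * m + 3)) ^ i) =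
    ∑ p ∈ antidiagonal M,
      partialTheta X m p.1 * gaussBinom (X ^ (2 * m + 3)) p.2 (2 * p.1 + p.2 + 1) := by
  have hX : (X : ℤ⟦X⟧) * X ^ (2 * m + 2) = X ^ (2 * m + 3) := (pow_succ' _ _).symm
  have h := prod_mul_prod_succ_eq_sum (z := (X : ℤ⟦X⟧)) (w := X ^ (2 * m + 2)) (fun n => by
    rw [hX, ← pow_mul]
    exact X_pow_succ_ne_one ((2 * m + 3) * n + (2 * m + 2))) M
  rw [hX] at h
  rw [h]
  refine sum_congr rfl fun p _ => ?_
  rw [partialTheta]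
  congr 2
  rw [mul_assoc _ _ ((X ^ (2 * m + 2)) ^ p.1), ← pow_mul, ← pow_mul, ← pow_add]
  congr 2
  have hchoose : ∀ r : ℕ, r * (r + 1) = 2 * r.choose 2 + 2 * r := fun r => by
    induction r with
    | zero => rfl
    | succ r ih =>
      rw [Nat.choose_succ_succ', Nat.choose_one_right]
      linarith
  rw [hchoose]
  ring

lemma eventually_coeff_prod_eq {f : ℕ → ℤ⟦X⟧} {g : ℤ⟦X⟧} (h : HasProd f g) (n : ℕ) :
    ∀ᶠ L in atTop, X ^ (n + 1) ∣ ∏ i ∈ range L, f i - g := by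
  have h1 := (WithPiTopology.tendsto_iff_coeff_tendsto _ _ _ _).1 h.tendsto_prod_nat
  simp only [nhds_discrete, tendsto_pure] at h1
  filter_upwards [(eventually_all_finset (range (n + 1))).2 fun i _ => h1 i] with L hL
  rw [X_pow_dvd_iff]
  intro i hi
  rw [map_sub, hL i (mem_range.2 hi), sub_self]

lemma coeff_alhGenFun_odd (m n : ℕ) : ∃ M, n ≤ M ∧
    coeff n (alhGenFun (X : ℤ⟦X⟧) (2 * m + 1) M) = coeff n
      ((PowerSeries.mk fun a => (#(Nat.Partition.countRestricted a 2) : ℤ)) *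
        PowerSeries.mk fun b => (#(Nat.Partition.restricted b fun x => x % (2 * m + 3) ≠ 0 ∧
          x % (2 * m + 3) ≠ 1 ∧ x % (2 * m + 3) ≠ 2 * m + 3 - 1) : ℤ)) := by
  set p : ℕ → Prop := fun x => x % (2 * m + 3) ≠ 0 ∧ x % (2 * m + 3) ≠ 1 ∧
    x % (2 * m + 3) ≠ 2 * m + 3 - 1
  set A : ℤ⟦X⟧ := PowerSeries.mk fun a => (#(Nat.Partition.countRestricted a 2) : ℤ)
  set B : ℤ⟦X⟧ := PowerSeries.mk fun b => (#(Nat.Partition.restricted b p) : ℤ)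
  have hA := eventually_coeff_prod_eq
    (Nat.Partition.hasProd_powerSeriesMk_card_countRestricted ℤ (m := 2) (by omega)) n
  have hB := eventually_coeff_prod_eq
    (Nat.Partition.hasProd_powerSeriesMk_card_restricted ℤ p) n
  have hmul : Tendsto (fun M => (2 * m + 3) * M) atTop atTop :=
    tendsto_id.const_mul_atTop' (by omega)
  obtain ⟨M, hA, hB, hM⟩ :=
    (hA.and ((hmul.eventually hB).and (eventually_ge_atTop (2 * n + 1)))).exists
  refine ⟨M, by omega, ?_⟩
  set φ := Ideal.Quotient.mk (Ideal.span {(X : ℤ⟦X⟧) ^ (n + 1)})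
  have hφ : ∀ {f g : ℤ⟦X⟧}, φ f = φ g ↔ X ^ (n + 1) ∣ f - g := fun {f g} => by
    rw [Ideal.Quotient.eq, Ideal.mem_span_singleton]
  suffices h : φ (alhGenFun X (2 * m + 1) M) = φ (A * B) by
    rw [← sub_eq_zero, ← map_sub]
    exact X_pow_dvd_iff.1 (hφ.1 h) n (Nat.lt_succ_self n)
  have hq : φ X ^ (n + 1) = 0 := by
    rw [← map_pow, ← map_zero φ, hφ, sub_zero]
  have hQ : (φ X ^ (2 * m + 3)) ^ (n + 1) = 0 := by
    rw [pow_right_comm, hq, zero_pow (by omega)]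
  have hpt : ∀ r, n < r → partialTheta (φ X) m r = 0 := fun r => partialTheta_eq_zero hq m
  have hA' : qFactPlus (φ X) M = φ A := by
    rw [← hφ.2 hA, ← map_qFactPlus, qFactPlus]
    simp [sum_range_succ]
  have hB' : φ B * ∏ i ∈ range ((2 * m + 3) * M),
      (if p (i + 1) then 1 - φ X ^ (i + 1) else 1) = 1 := by
    have hite : ∀ i, (if p (i + 1) then 1 - φ X ^ (i + 1) else 1) =
        φ (if p (i + 1) then 1 - X ^ (i + 1) else 1) := fun i => by
      split_ifs <;> simp
    simp only [hite]
    rw [← hφ.2 hB, ← map_prod, ← map_mul, ← prod_mul_distrib, ← map_one φ]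
    congr 1
    refine prod_eq_one fun i _ => ?_
    split_ifs
    · simp only [pow_mul]
      exact WithPiTopology.tsum_pow_mul_one_sub_of_constantCoeff_eq_zero (by simp)
    · exact mul_one 1
  have h1 := congrArg φ (alhGenFun_X_mul_qFact m M)
  have h2 := congrArg φ (prod_mul_prod_eq_sum_partialTheta m M)
  simp only [map_mul, map_sum, map_prod, map_sub, map_one, map_pow, map_alhGenFun, map_qFact,
    map_qFactPlus, map_partialTheta, map_gaussBinom] at h1 h2
  rw [qFact_eq_of_pow_eq_zero hq (L := 2 * M + 1) (by omega),
    qFact_eq_of_pow_eq_zero hq (L := M) (by omega), mul_assoc,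
    mul_comm (qFact _ n), sum_mul_gaussBinom_mul_qFact_of_pow_eq_zero hq hpt (by omega), hA'] at h1
  have h3 := sum_mul_gaussBinom_mul_qFact_of_pow_eq_zero hQ hpt (M := M) (by omega)
  rw [← h2, prod_range_succ, pow_eq_zero_of_le (by omega) hQ, mul_zero, sub_zero, mul_one] at h3
  have h4 := qFact_mul_eq_prod_residues (φ X) m M
  rw [qFact_eq_of_pow_eq_zero hq (by nlinarith), qFact_eq_of_pow_eq_zero hQ (by omega), h3] at h4
  refine (isUnit_qFact_of_pow_eq_zero hq n).mul_right_cancel ?_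
  rw [map_alhGenFun, h1, map_mul, mul_assoc, h4, ← mul_assoc (φ B), hB', one_mul]

end Limit

/-- For `k ≥ 2` and `n ≥ 1`, `|F_{2k-3}(n)| = |H_{2k-1}(n)|`. -/
theorem alh_eq_overpartitions_odd (k n : ℕ) (hk : 2 ≤ k) (hn : 0 < n) :
    (Fset (2 * k - 3) n).ncard = (Hset (2 * k - 1) n).ncard := by
  obtain ⟨m, rfl⟩ := Nat.exists_eq_add_of_le' hk
  obtain ⟨M, hM, h⟩ := coeff_alhGenFun_odd m n
  rw [show 2 * (m + 2) - 3 = 2 * m + 1 by omega, show 2 * (m + 2) - 1 = 2 * m + 3 by omega]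
  exact_mod_cast (ncard_Fset hM).trans (h.trans (ncard_Hset_eq_coeff _ n).symm)
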